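/- arXiv:1304.7332 — 2 statements merged into one kernel-verified Lean document; each statement's English description precedes it below -/
import Mathlib

section
/- A noetherian ring A is almost Cohen-Macaulay if and only if ht(P) ≤ 1 + depth_P(A) for every prime ideal P of A. -/
open IsLocalRing

/-- The `I`-depth (grade) of an `A`-module `M`: the supremum of lengths of
`M`-regular sequences with entries in `I`. -/
noncomputable def idealDepth {A : Type*} [CommRing A] (I : Ideal A)
    (M : Type*) [AddCommGroup M] [Module A M] : ℕ∞ :=
  sSup {n : ℕ∞ | ∃ rs : List A, (rs.length : ℕ∞) = n ∧ (∀ r ∈ rs, r ∈ I) ∧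
    RingTheory.Sequence.IsRegular M rs}

/-- The depth of a local ring: the depth with respect to its maximal ideal. -/
noncomputable def ringDepth (A : Type*) [CommRing A] [IsLocalRing A] : ℕ∞ :=
  idealDepth (IsLocalRing.maximalIdeal A) A

/-- depth(A_P), the depth of the localization of `A` at the prime `P`. -/
noncomputable def localDepth {A : Type*} [CommRing A] (P : Ideal A) [P.IsPrime] : ℕ∞ :=
  ringDepth (Localization.AtPrime P)

/-- The height of a prime ideal. -/
noncomputable def primeHeight {A : Type*} [CommRing A] (P : Ideal A) [P.IsPrime] : ℕ∞ :=
  Order.height (⟨P, inferInstance⟩ : PrimeSpectrum A)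

/-- A noetherian local ring is almost Cohen-Macaulay if `dim A ≤ 1 + depth A`. -/
def IsAlmostCM (A : Type*) [CommRing A] [IsLocalRing A] : Prop :=
  ringKrullDim A ≤ ((1 + ringDepth A : ℕ∞) : WithBot ℕ∞)

/-- Almost Cohen-Macaulay for a (local) ring presented with an explicit maximal ideal `I`:
`dim R ≤ 1 + depth_I R`. -/
def IsAlmostCMWith (R : Type*) [CommRing R] (I : Ideal R) : Prop :=
  ringKrullDim R ≤ ((1 + idealDepth I R : ℕ∞) : WithBot ℕ∞)

/-- A ring is almost Cohen-Macaulay (Han/Kang) if `depth_P A = depth (A_P)` for all primes. -/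
def IsACM (A : Type*) [CommRing A] : Prop :=
  ∀ (P : Ideal A) [P.IsPrime], idealDepth P A = localDepth P

/-- Serre's condition `(S_k)`: `depth A_P ≥ min (ht P, k)` for all primes `P`. -/
def SerreCond (k : ℕ) (A : Type*) [CommRing A] : Prop :=
  ∀ (P : Ideal A) [P.IsPrime], min (primeHeight P) (k : ℕ∞) ≤ localDepth P

/-- The condition `(C_k)`: `depth A_P ≥ min (ht P, k) - 1` for all primes `P`. -/
def CondC (k : ℕ) (A : Type*) [CommRing A] : Prop :=
  ∀ (P : Ideal A) [P.IsPrime], min (primeHeight P) (k : ℕ∞) ≤ 1 + localDepth P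

universe u

open Pointwise CategoryTheory CategoryTheory.Abelian RingTheory.Sequence

lemma smul_top_quotSMulTop_ne_top {R M : Type*} [CommRing R] [AddCommGroup M] [Module R M]
    {I : Ideal R} {r : R} (hr : r ∈ I) (hI : I • (⊤ : Submodule R M) ≠ ⊤) :
    I • (⊤ : Submodule R (QuotSMulTop r M)) ≠ ⊤ := by
  intro h
  apply hI
  simpa [Submodule.comap_smul_top_of_surjective I _ (Submodule.mkQ_surjective _),
    Submodule.smul_mono_left ((Ideal.span_singleton_le_iff_mem I).mpr hr),
    ← Submodule.ideal_span_singleton_smul] using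
      congrArg (Submodule.comap (Submodule.mkQ _)) h

/-- An ideal containing a regular sequence of length `n + 1` on `M` also contains one of length `n`
on `M / xM`, for every `M`-regular element `x` of the ideal. -/
lemma exists_isRegular_quotSMulTop {R M : Type u} [CommRing R] [IsNoetherianRing R]
    [AddCommGroup M] [Module R M] [Module.Finite R M] {I : Ideal R}
    (hI : I • (⊤ : Submodule R M) ≠ ⊤) {x : R} (hx : x ∈ I) (hreg : IsSMulRegular M x)
    {n : ℕ} (h : ∃ rs : List R, rs.length = n + 1 ∧ (∀ r ∈ rs, r ∈ I) ∧ IsRegular M rs) :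
    ∃ rs : List R, rs.length = n ∧ (∀ r ∈ rs, r ∈ I) ∧ IsRegular (QuotSMulTop x M) rs := by
  have h_ext := ((ModuleCat.exists_isRegular_tfae I (n + 1) (ModuleCat.of R M)
    hI.lt_top).out 1 3).mpr h
  refine ((ModuleCat.exists_isRegular_tfae I n (ModuleCat.of R (QuotSMulTop x M))
    (smul_top_quotSMulTop_ne_top hx hI).lt_top).out 1 3).mp fun i hi ↦ ?_
  have zero₁ := AddCommGrpCat.isZero_of_iff_subsingleton.mpr (h_ext i (by omega))
  have zero₂ := AddCommGrpCat.isZero_of_iff_subsingleton.mpr (h_ext (i + 1) (by omega))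
  have hreg' : IsSMulRegular (ModuleCat.of R M) x := hreg
  exact AddCommGrpCat.subsingleton_of_isZero <| ShortComplex.Exact.isZero_of_both_zeros
    (Ext.covariant_sequence_exact₃' _ hreg'.smulShortComplex_shortExact i (i + 1) rfl)
    (zero₁.eq_zero_of_src _) (zero₂.eq_zero_of_tgt _)

/-- If `I` contains a weakly regular sequence longer than `rs`, then `rs` can be extended
inside `I`. -/
lemma exists_isWeaklyRegular_append_singleton {R M : Type u} [CommRing R] [IsNoetherianRing R]
    [AddCommGroup M] [Module R M] [Module.Finite R M] {I : Ideal R}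
    (hI : I • (⊤ : Submodule R M) ≠ ⊤) {rs ss : List R} (hrs : ∀ r ∈ rs, r ∈ I)
    (hreg : IsWeaklyRegular M rs) (hss : ∀ r ∈ ss, r ∈ I) (hreg' : IsRegular M ss)
    (hlen : ss.length = rs.length + 1) : ∃ a ∈ I, IsWeaklyRegular M (rs ++ [a]) := by
  induction rs generalizing M ss with
  | nil =>
    obtain ⟨a, rfl⟩ := List.length_eq_one_iff.mp hlen
    exact ⟨a, hss a (by simp), hreg'.1⟩
  | cons x rs ih =>
    rw [isWeaklyRegular_cons_iff] at hreg
    have hx : x ∈ I := hrs x (by simp)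
    obtain ⟨ts, hlen', hts, htreg⟩ :=
      exists_isRegular_quotSMulTop hI hx hreg.1 ⟨ss, hlen, hss, hreg'⟩
    obtain ⟨a, ha, hareg⟩ := ih (smul_top_quotSMulTop_ne_top hx hI)
      (fun r hr ↦ hrs r (by simp [hr])) hreg.2 hts htreg hlen'
    exact ⟨a, ha, by simpa using ⟨hreg.1, hareg⟩⟩

/-- A weakly regular sequence can be extended by an element of `I` unless `I` is contained
in an associated prime of the quotient. -/
lemma exists_isWeaklyRegular_append_singleton_iff {R M : Type*} [CommRing R] [IsNoetherianRing R]
    [AddCommGroup M] [Module R M] [Module.Finite R M] {I : Ideal R} {rs : List R}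
    (hreg : IsWeaklyRegular M rs) :
    (∃ a ∈ I, IsWeaklyRegular M (rs ++ [a])) ↔
      ¬ ∃ p ∈ associatedPrimes R (M ⧸ (Ideal.ofList rs • ⊤ : Submodule R M)), I ≤ p := by
  simp only [isWeaklyRegular_append_iff, hreg, true_and, isWeaklyRegular_singleton_iff]
  have key := Ideal.subset_union_prime_finite (I := I) (f := id)
    (associatedPrimes.finite R (M ⧸ (Ideal.ofList rs • ⊤ : Submodule R M))) 0 0
    fun _ h _ _ ↦ h.isPrime
  simp only [id] at key
  rw [← key]
  simp only [ biUnion_associatedPrimes_eq_compl_regular, Set.not_subset, Set.mem_compl_iff,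
    not_not, Set.mem_ofPred_eq, SetLike.mem_coe]

lemma isRegular_of_isWeaklyRegular_of_mem {R : Type*} [CommRing R] {I : Ideal R} (hI : I ≠ ⊤)
    {rs : List R} (hrs : ∀ r ∈ rs, r ∈ I) (hreg : IsWeaklyRegular R rs) : IsRegular R rs := by
  refine ⟨hreg, fun h ↦ hI ?_⟩
  rw [smul_eq_mul, Ideal.mul_top] at h
  exact top_le_iff.mp (h.trans_le (Ideal.span_le.mpr hrs))

lemma length_le_idealDepth {R : Type*} [CommRing R] {I : Ideal R} (hI : I ≠ ⊤)
    {rs : List R} (hrs : ∀ r ∈ rs, r ∈ I) (hreg : IsWeaklyRegular R rs) :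
    (rs.length : ℕ∞) ≤ idealDepth I R :=
  le_sSup ⟨rs, rfl, hrs, isRegular_of_isWeaklyRegular_of_mem hI hrs hreg⟩

/-- A weakly regular sequence in a proper ideal computes the depth exactly when the ideal is
contained in an associated prime of the quotient. -/
lemma idealDepth_eq_length_iff {R : Type*} [CommRing R] [IsNoetherianRing R] {I : Ideal R}
    (hI : I ≠ ⊤) {rs : List R} (hrs : ∀ r ∈ rs, r ∈ I) (hreg : IsWeaklyRegular R rs) :
    idealDepth I R = rs.length ↔
      ∃ p ∈ associatedPrimes R (R ⧸ (Ideal.ofList rs • ⊤ : Submodule R R)), I ≤ p := by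
  rw [← not_iff_not, ← exists_isWeaklyRegular_append_singleton_iff hreg]
  constructor
  · intro h
    have hlt := (length_le_idealDepth hI hrs hreg).lt_of_ne' h
    obtain ⟨_, ⟨ss, rfl, hss, hss'⟩, hlen⟩ := lt_sSup_iff.mp hlt
    rw [Nat.cast_lt] at hlen
    refine exists_isWeaklyRegular_append_singleton (by simpa using hI) hrs hreg
      (ss := ss.take (rs.length + 1)) (fun r hr ↦ hss r (List.mem_of_mem_take hr)) ?_
      (by simpa using hlen)
    refine isRegular_of_isWeaklyRegular_of_mem hI
      (fun r hr ↦ hss r (List.mem_of_mem_take hr)) ?_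
    have := hss'.1
    rw [← List.take_append_drop (rs.length + 1) ss, isWeaklyRegular_append_iff] at this
    exact this.1
  · rintro ⟨a, ha, hareg⟩ h
    have := length_le_idealDepth hI (rs := rs ++ [a]) (by simpa [or_imp, forall_and, ha] using hrs)
      hareg
    rw [h, Nat.cast_le] at this
    simp at this

/-- The depth of a prime is at most its height. -/
lemma idealDepth_le_height {R : Type*} [CommRing R] [IsNoetherianRing R] (P : Ideal R)
    [P.IsPrime] : idealDepth P R ≤ P.height := by
  refine sSup_le ?_
  rintro _ ⟨rs, rfl, hrs, hreg⟩
  have hreg' := hreg.1.isRegular_of_isLocalization_of_mem (Localization.AtPrime P) P hrs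
  have h := ringKrullDim_add_length_eq_ringKrullDim_of_isRegular _ hreg'
  rw [IsLocalization.AtPrime.ringKrullDim_eq_height P (Localization.AtPrime P),
    List.length_map] at h
  have hdim : 0 ≤ ringKrullDim (Localization.AtPrime P ⧸
      Ideal.ofList (rs.map (algebraMap R (Localization.AtPrime P)))) := by
    have := Ideal.Quotient.nontrivial_iff.mpr fun h ↦ hreg'.2 (by simpa using h.symm)
    exact ringKrullDim_nonneg_of_nontrivial
  rw [← WithBot.coe_le_coe, ← h]
  exact le_add_of_nonneg_left hdim

/-- The depth of a prime is attained by a weakly regular sequence. -/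
lemma exists_isWeaklyRegular_length_eq_idealDepth {R : Type*} [CommRing R] [IsNoetherianRing R]
    (P : Ideal R) [hP : P.IsPrime] :
    ∃ rs : List R, (∀ r ∈ rs, r ∈ P) ∧ IsWeaklyRegular R rs ∧ idealDepth P R = rs.length := by
  have : Nontrivial R := (Submodule.nontrivial_iff R).mp (nontrivial_of_ne P ⊤ hP.ne_top)
  have : Nonempty {n : ℕ∞ | ∃ rs : List R, (rs.length : ℕ∞) = n ∧ (∀ r ∈ rs, r ∈ P) ∧
      IsRegular R rs} := ⟨0, [], by simp [IsRegular.nil]⟩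
  obtain ⟨rs, hlen, hrs, hreg⟩ := ENat.sSup_mem_of_nonempty_of_lt_top
    ((idealDepth_le_height P).trans_lt (P.height_ne_top hP.ne_top).lt_top)
  exact ⟨rs, hrs, hreg.1, hlen.symm⟩

/-- Associated primes of the quotient by a sequence can be tested after localizing. -/
lemma maximalIdeal_mem_associatedPrimes_quotient_iff {R : Type*} [CommRing R] [IsNoetherianRing R]
    (Q : Ideal R) [Q.IsPrime] (rs : List R) :
    maximalIdeal (Localization.AtPrime Q) ∈ associatedPrimes (Localization.AtPrime Q)
      (Localization.AtPrime Q ⧸ (Ideal.ofList (rs.map (algebraMap R (Localization.AtPrime Q))) • ⊤ :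
        Submodule (Localization.AtPrime Q) (Localization.AtPrime Q))) ↔
      Q ∈ associatedPrimes R (R ⧸ (Ideal.ofList rs • ⊤ : Submodule R R)) := by
  have h : (Ideal.ofList rs • ⊤ : Submodule R R).localized' (Localization.AtPrime Q) Q.primeCompl
      (Algebra.linearMap R (Localization.AtPrime Q)) =
      Ideal.ofList (rs.map (algebraMap R (Localization.AtPrime Q))) • ⊤ := by
    rw [Submodule.localized'_smul, Submodule.localized'_top, Ideal.localized'_eq_map,
      Ideal.map_ofList]
  have key :=
    Module.associatedPrimes.preimage_comap_associatedPrimes_eq_associatedPrimes_of_isLocalizedModule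
      Q.primeCompl (Localization.AtPrime Q)
      ((Ideal.ofList rs • ⊤ : Submodule R R).toLocalizedQuotient'
        (Localization.AtPrime Q) Q.primeCompl (Algebra.linearMap R (Localization.AtPrime Q)))
  rw [← h, ← key, Set.mem_preimage]
  exact iff_of_eq (congrArg (· ∈ _) (IsLocalization.AtPrime.under_maximalIdeal _ Q))

lemma mem_maximalIdeal_of_mem_map_algebraMap {R : Type*} [CommRing R] (Q : Ideal R) [Q.IsPrime]
    {rs : List R} (hrs : ∀ r ∈ rs, r ∈ Q) :
    ∀ r ∈ rs.map (algebraMap R (Localization.AtPrime Q)),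
      r ∈ maximalIdeal (Localization.AtPrime Q) := by
  intro _ hr
  obtain ⟨r, hr', rfl⟩ := List.mem_map.mp hr
  exact (IsLocalization.AtPrime.to_map_mem_maximal_iff _ Q r).mpr (hrs r hr')

/-- A weakly regular sequence in `Q` computes `depth A_Q` exactly when `Q` is an associated prime
of the quotient. -/
lemma localDepth_eq_length_iff {R : Type*} [CommRing R] [IsNoetherianRing R] (Q : Ideal R)
    [Q.IsPrime] {rs : List R} (hrs : ∀ r ∈ rs, r ∈ Q) (hreg : IsWeaklyRegular R rs) :
    localDepth Q = rs.length ↔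
      Q ∈ associatedPrimes R (R ⧸ (Ideal.ofList rs • ⊤ : Submodule R R)) := by
  have hreg' := hreg.of_isLocalization (Localization.AtPrime Q) Q.primeCompl
  have key := idealDepth_eq_length_iff Ideal.IsPrime.ne_top'
    (mem_maximalIdeal_of_mem_map_algebraMap Q hrs) hreg'
  rw [List.length_map] at key
  rw [← maximalIdeal_mem_associatedPrimes_quotient_iff, localDepth, ringDepth, key]
  constructor
  · rintro ⟨p, hp, hle⟩
    rwa [(maximalIdeal.isMaximal _).eq_of_le hp.isPrime.ne_top hle]
  · exact fun h ↦ ⟨_, h, le_rfl⟩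

lemma length_le_localDepth {R : Type*} [CommRing R] (Q : Ideal R)
    [Q.IsPrime] {rs : List R} (hrs : ∀ r ∈ rs, r ∈ Q) (hreg : IsWeaklyRegular R rs) :
    rs.length ≤ localDepth Q := by
  have hreg' := hreg.of_isLocalization (Localization.AtPrime Q) Q.primeCompl
  simpa using! length_le_idealDepth Ideal.IsPrime.ne_top'
    (mem_maximalIdeal_of_mem_map_algebraMap Q hrs) hreg'

lemma localDepth_le_height {R : Type*} [CommRing R] [IsNoetherianRing R] (Q : Ideal R)
    [Q.IsPrime] : localDepth Q ≤ Q.height := by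
  refine (idealDepth_le_height (maximalIdeal (Localization.AtPrime Q))).trans_eq ?_
  rw [← WithBot.coe_inj, maximalIdeal_height_eq_ringKrullDim,
    IsLocalization.AtPrime.ringKrullDim_eq_height Q]

/-- If `depth_Q R = depth R_Q` for all primes `Q`, then `ht P ≤ 1 + depth_P R`. -/
lemma height_le_one_add_idealDepth_of_isACM {R : Type*} [CommRing R] [IsNoetherianRing R]
    (h : IsACM R) (P : Ideal R) [hP : P.IsPrime] : P.height ≤ 1 + idealDepth P R := by
  classical
  obtain ⟨rs, hrs, hreg, hdepth⟩ := exists_isWeaklyRegular_length_eq_idealDepth P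
  obtain ⟨p, hp, hPp⟩ := (idealDepth_eq_length_iff hP.ne_top hrs hreg).mp hdepth
  obtain ⟨y, hyP, hy⟩ : ∃ y ∈ P, ∀ q ∈ associatedPrimes R
      (R ⧸ (Ideal.ofList rs • ⊤ : Submodule R R)), ¬ P ≤ q → y ∉ q := by
    by_contra! hc
    obtain ⟨q, hq, hle⟩ := (Ideal.subset_union_prime_finite (I := P) (f := id)
      ((associatedPrimes.finite R (R ⧸ (Ideal.ofList rs • ⊤ : Submodule R R))).sep (¬ P ≤ ·)) 0 0
      fun _ h _ _ ↦ h.1.isPrime).mp fun y hyP ↦ by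
        obtain ⟨q, hq, hPq, hyq⟩ := hc y hyP
        exact Set.mem_biUnion (⟨hq, hPq⟩ : q ∈ {q ∈ associatedPrimes R _ | ¬ P ≤ q}) hyq
    exact hq.2 hle
  have hmin : P ∈ (Ideal.span (insert y rs.toFinset : Finset R)).minimalPrimes := by
    refine ⟨⟨hP, Ideal.span_le.mpr ?_⟩, ?_⟩
    · intro r hr
      obtain rfl | hr := by simpa using hr
      exacts [hyP, hrs r hr]
    · rintro Q ⟨hQ, hle⟩ hQP
      have hrsQ : ∀ r ∈ rs, r ∈ Q := fun r hr ↦ hle (Ideal.subset_span (by simp [hr]))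
      have hyQ : y ∈ Q := hle (Ideal.subset_span (by simp))
      have hQd := (idealDepth_eq_length_iff hQ.ne_top hrsQ hreg).mpr ⟨p, hp, hQP.trans hPp⟩
      have hQa := (localDepth_eq_length_iff Q hrsQ hreg).mp ((h Q).symm.trans hQd)
      by_contra hPQ
      exact hy Q hQa hPQ hyQ
  refine (Ideal.height_le_card_of_mem_minimalPrimes_span_finset hmin).trans ?_
  rw [hdepth]
  have h₁ := Finset.card_insert_le y rs.toFinset
  have h₂ := rs.toFinset_card_le
  norm_cast
  omega

/-- If `ht Q ≤ 1 + depth_Q R` for all primes `Q`, then `depth_P R = depth R_P`. -/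
lemma idealDepth_eq_localDepth_of_height_le {R : Type*} [CommRing R] [IsNoetherianRing R]
    (h : ∀ (Q : Ideal R) [Q.IsPrime], Q.height ≤ 1 + idealDepth Q R) (P : Ideal R)
    [hP : P.IsPrime] : idealDepth P R = localDepth P := by
  obtain ⟨rs, hrs, hreg, hdepth⟩ := exists_isWeaklyRegular_length_eq_idealDepth P
  obtain ⟨Q, hQ, hPQ⟩ := (idealDepth_eq_length_iff hP.ne_top hrs hreg).mp hdepth
  by_contra hne
  rw [hdepth] at hne
  have hlt := (length_le_localDepth P hrs hreg).lt_of_ne hne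
  have := hQ.isPrime
  have hQd := (idealDepth_eq_length_iff this.ne_top (fun r hr ↦ hPQ (hrs r hr)) hreg).mpr
    ⟨Q, hQ, le_rfl⟩
  have hht : Q.height ≤ P.height := by
    refine (h Q).trans (le_trans ?_ (localDepth_le_height P))
    rw [hQd, add_comm]
    exact Order.add_one_le_of_lt hlt
  obtain rfl | hPQ' := hPQ.eq_or_lt
  · exact hne ((localDepth_eq_length_iff P hrs hreg).mpr hQ).symm
  · exact (Ideal.height_strict_mono_of_isPrime hPQ').not_ge hht

theorem isACM_iff_height_le_one_add_depth {A : Type*} [CommRing A] [IsNoetherianRing A] :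
    IsACM A ↔ ∀ (P : Ideal A) [P.IsPrime], primeHeight P ≤ 1 + idealDepth P A := by
  have hht : ∀ (P : Ideal A) [P.IsPrime], primeHeight P = P.height := fun P _ ↦
    (PrimeSpectrum.height_eq_orderHeight ⟨P, inferInstance⟩).symm
  simp only [hht]
  exact ⟨fun h P _ ↦ height_le_one_add_idealDepth_of_isACM h P,
    fun h P _ ↦ idealDepth_eq_localDepth_of_height_le h P⟩
end

section
/- Let u: (A,m) → (B,n) be a local flat morphism of noetherian local rings. If A and B/mB are almost Cohen-Macaulay and at least one of them is Cohen-Macaulay, then B is almost Cohen-Macaulay. -/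
open IsLocalRing

/-- Cohen-Macaulay for a (local) ring presented with an explicit maximal ideal. -/
def IsCMWith (R : Type*) [CommRing R] (I : Ideal R) : Prop :=
  ringKrullDim R = ((idealDepth I R : ℕ∞) : WithBot ℕ∞)

section FlatModules

variable {A M N Q : Type*} [CommRing A] [AddCommGroup M] [Module A M] [AddCommGroup N] [Module A N]
  [AddCommGroup Q] [Module A Q]

theorem Submodule.exists_sum_smul_of_mem_span_range_smul_top {n : ℕ} (f : Fin n → A) {x : M}
    (hx : x ∈ Ideal.span (Set.range f) • (⊤ : Submodule A M)) :
    ∃ w : Fin n → M, x = ∑ i, f i • w i := by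
  induction hx using Submodule.smul_induction_on' with
  | smul r hr m _ =>
    obtain ⟨c, rfl⟩ := Ideal.mem_span_range_iff_exists_fun.mp hr
    exact ⟨fun i => c i • m, by simp [Finset.sum_smul, smul_smul, mul_comm]⟩
  | add x _ y _ hx hy =>
    obtain ⟨u, rfl⟩ := hx
    obtain ⟨v, rfl⟩ := hy
    exact ⟨u + v, by simp [Finset.sum_add_distrib]⟩

theorem Module.Flat.mem_smul_top_of_smul_mem_smul_top [Module.Flat A M] {I J : Ideal A}
    (hI : I.FG) {a : A} (hJ : ∀ b, a * b ∈ I → b ∈ J) {v : M}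
    (hv : a • v ∈ I • (⊤ : Submodule A M)) : v ∈ J • (⊤ : Submodule A M) := by
  obtain ⟨n, f, rfl⟩ := Submodule.fg_iff_exists_fin_generating_family.mp hI
  obtain ⟨w, hw⟩ := Submodule.exists_sum_smul_of_mem_span_range_smul_top f hv
  have hrel : ∑ i : Option (Fin n), (i.elim a (fun j => -f j)) • (i.elim v w) = 0 := by
    simp [Fintype.sum_option, hw]
  obtain ⟨k, c, y, hy, hc⟩ := Module.Flat.isTrivialRelation_of_sum_smul_eq_zero hrel
  rw [show v = ∑ j, c none j • y j from hy none]
  refine Submodule.sum_mem _ fun j _ => Submodule.smul_mem_smul (hJ _ ?_) Submodule.mem_top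
  have h := hc j
  simp only [Fintype.sum_option, Option.elim, neg_mul, Finset.sum_neg_distrib] at h
  rw [add_neg_eq_zero.mp h]
  exact Submodule.sum_mem _ fun i _ =>
    Ideal.mul_mem_right _ _ (Submodule.subset_span (Set.mem_range_self i))

theorem IsLocalRing.exists_notMem_forall_mem_maximalIdeal_mul_mem [IsLocalRing A] {I : Ideal A}
    {k : ℕ} (hk : maximalIdeal A ^ k ≤ I) (hI : I ≠ ⊤) :
    ∃ a ∉ I, ∀ b ∈ maximalIdeal A, b * a ∈ I := by
  induction k with
  | zero => simp_all
  | succ k ih =>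
    by_cases h : maximalIdeal A ^ k ≤ I
    · exact ih h
    · obtain ⟨a, ha, haI⟩ := SetLike.not_le_iff_exists.mp h
      exact ⟨a, haI, fun b hb => hk (pow_succ' (maximalIdeal A) k ▸ Ideal.mul_mem_mul hb ha)⟩

/-- If `φ` is injective modulo the maximal ideal and its target is flat, then it is injective
modulo every ideal containing a power of the maximal ideal. -/
theorem Module.Flat.mem_smul_top_of_map_mem_of_pow_le [IsNoetherianRing A] [IsLocalRing A]
    [Module.Flat A N] {φ : M →ₗ[A] N}
    (hφ : ∀ z, φ z ∈ maximalIdeal A • (⊤ : Submodule A N) →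
      z ∈ maximalIdeal A • (⊤ : Submodule A M))
    {k : ℕ} (I : Ideal A) (hk : maximalIdeal A ^ k ≤ I) {z : M}
    (hz : φ z ∈ I • (⊤ : Submodule A N)) : z ∈ I • (⊤ : Submodule A M) := by
  induction I using WellFoundedGT.induction generalizing z with
  | ind I ih =>
    by_cases hI : I = ⊤
    · simp [hI]
    obtain ⟨a, haI, ham⟩ := IsLocalRing.exists_notMem_forall_mem_maximalIdeal_mul_mem hk hI
    have hlt : I < I ⊔ Ideal.span {a} := lt_of_le_of_ne le_sup_left fun h =>
      haI (h ▸ Submodule.mem_sup_right (Ideal.mem_span_singleton_self a))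
    have hz' := ih _ hlt (hk.trans hlt.le) (Submodule.smul_mono_left hlt.le hz)
    rw [Submodule.sup_smul, Submodule.ideal_span_singleton_smul] at hz'
    obtain ⟨w, hw, u, hu, rfl⟩ := Submodule.mem_sup.mp hz'
    obtain ⟨v, -, rfl⟩ := (Submodule.mem_smul_pointwise_iff_exists _ _ _).mp hu
    have hav : a • φ v ∈ I • (⊤ : Submodule A N) := by
      rw [map_add, map_smul] at hz
      exact ((I • (⊤ : Submodule A N)).add_mem_iff_right
        (Submodule.smul_top_le_comap_smul_top I φ hw)).mp hz
    have hv := hφ v <| Module.Flat.mem_smul_top_of_smul_mem_smul_top (IsNoetherian.noetherian I)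
      (J := maximalIdeal A) (fun b hb => by
        by_contra hb'
        exact haI ((Ideal.mul_unit_mem_iff_mem I (notMem_maximalIdeal.mp hb')).mp hb)) hav
    refine add_mem hw ?_
    have hle : Ideal.span {a} * maximalIdeal A ≤ I := by
      rw [Ideal.span_singleton_mul_le_iff]
      exact fun b hb => mul_comm b a ▸ ham b hb
    refine Submodule.smul_mono_left hle ?_
    rw [Submodule.mul_smul]
    exact Submodule.smul_mem_smul (Ideal.mem_span_singleton_self a) hv

/-- A cokernel of a map into a flat module is flat if the map is injective modulo every ideal. -/
theorem Module.Flat.of_exact_of_forall_mem_smul_top [Module.Flat A N] {φ : M →ₗ[A] N}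
    {π : N →ₗ[A] Q} (hex : Function.Exact φ π) (hπ : Function.Surjective π)
    (hφ : ∀ (I : Ideal A) (z : M), φ z ∈ I • (⊤ : Submodule A N) → z ∈ I • (⊤ : Submodule A M)) :
    Module.Flat A Q := by
  refine Module.Flat.of_forall_isTrivialRelation fun {l f x} h => ?_
  choose s hs using fun i => hπ (x i)
  obtain ⟨z, hz⟩ := (hex (∑ i, f i • s i)).mp (by simpa [hs] using h)
  obtain ⟨w, rfl⟩ := Submodule.exists_sum_smul_of_mem_span_range_smul_top f <|
    hφ (Ideal.span (Set.range f)) z <| hz ▸ Submodule.sum_mem _ fun i _ =>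
      Submodule.smul_mem_smul (Submodule.subset_span (Set.mem_range_self i)) Submodule.mem_top
  have hrel : ∑ i, f i • (s i - φ (w i)) = 0 := by
    simp [smul_sub, Finset.sum_sub_distrib, ← hz]
  obtain ⟨k, c, y, hy, hc⟩ := Module.Flat.isTrivialRelation_of_sum_smul_eq_zero hrel
  refine ⟨k, c, π ∘ y, fun i => ?_, hc⟩
  simpa [hs, hex.apply_apply_eq_zero] using congrArg π (hy i)

end FlatModules

open scoped Pointwise in
/-- The quotients of `M` by `J` and by `y` commute. -/
noncomputable def QuotSMulTop.quotientSMulTopEquiv {B M : Type*} [CommRing B]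
    [AddCommGroup M] [Module B M] (J : Ideal B) (y : B) :
    QuotSMulTop y (M ⧸ (J • (⊤ : Submodule B M))) ≃ₗ[B]
      QuotSMulTop y M ⧸ (J • (⊤ : Submodule B (QuotSMulTop y M))) :=
  Submodule.quotEquivOfEq _ _ (by rw [Submodule.map_pointwise_smul, Submodule.map_top,
      Submodule.range_mkQ]) ≪≫ₗ
    Submodule.quotientQuotientEquivQuotientSup (J • ⊤) (y • ⊤) ≪≫ₗ
    Submodule.quotEquivOfEq _ _ (sup_comm _ _) ≪≫ₗ
    (Submodule.quotientQuotientEquivQuotientSup (y • ⊤) (J • ⊤)).symm ≪≫ₗ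
    Submodule.quotEquivOfEq _ _ (by rw [Submodule.map_smul'', Submodule.map_top,
      Submodule.range_mkQ])

/-- A form of Krull's intersection theorem. -/
theorem IsLocalRing.mem_smul_top_of_forall_mem_sup_pow_smul_top {B M : Type*} [CommRing B]
    [IsNoetherianRing B] [IsLocalRing B] [AddCommGroup M] [Module B M] [Module.Finite B M]
    (I : Ideal B) {z : M}
    (hz : ∀ k, z ∈ (I ⊔ maximalIdeal B ^ k) • (⊤ : Submodule B M)) :
    z ∈ I • (⊤ : Submodule B M) := by
  rw [← Submodule.Quotient.mk_eq_zero, ← Submodule.mem_bot B,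
    ← Ideal.iInf_pow_smul_eq_bot_of_isLocalRing (maximalIdeal B) Ideal.IsPrime.ne_top',
    Submodule.mem_iInf]
  intro k
  have h := hz k
  rw [Submodule.sup_smul] at h
  obtain ⟨u, hu, v, hv, rfl⟩ := Submodule.mem_sup.mp h
  rw [Submodule.Quotient.mk_add, (Submodule.Quotient.mk_eq_zero _).mpr hu, zero_add]
  exact Submodule.smul_top_le_comap_smul_top _ (Submodule.mkQ _) hv

theorem Ideal.mem_map_smul_top_iff {A B M : Type*} [CommRing A] [CommRing B] [Algebra A B]
    [AddCommGroup M] [Module A M] [Module B M] [IsScalarTower A B M] (I : Ideal A) (z : M) :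
    z ∈ I.map (algebraMap A B) • (⊤ : Submodule B M) ↔ z ∈ I • (⊤ : Submodule A M) := by
  rw [← Submodule.restrictScalars_mem A, Ideal.smul_restrictScalars, Submodule.restrictScalars_top]

section LocalFlat

open RingTheory.Sequence

variable {A B : Type*} [CommRing A] [CommRing B] [IsNoetherianRing A] [IsNoetherianRing B]
  [IsLocalRing A] [IsLocalRing B] [Algebra A B] [IsLocalHom (algebraMap A B)]
  {M : Type*} [AddCommGroup M] [Module A M] [Module B M] [IsScalarTower A B M] [Module.Finite B M]

theorem IsSMulRegular.mem_smul_top_of_flat [Module.Flat A M] {y : B}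
    (hy : IsSMulRegular
      (M ⧸ ((maximalIdeal A).map (algebraMap A B) • (⊤ : Submodule B M))) y)
    (I : Ideal A) {z : M} (hz : y • z ∈ I • (⊤ : Submodule A M)) :
    z ∈ I • (⊤ : Submodule A M) := by
  rw [isSMulRegular_quotient_iff_mem_of_smul_mem] at hy
  simp only [Ideal.mem_map_smul_top_iff] at hy
  rw [← Ideal.mem_map_smul_top_iff (B := B)]
  refine IsLocalRing.mem_smul_top_of_forall_mem_sup_pow_smul_top _ fun k => ?_
  have hle : (I ⊔ maximalIdeal A ^ k).map (algebraMap A B) ≤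
      I.map (algebraMap A B) ⊔ maximalIdeal B ^ k := by
    rw [Ideal.map_sup, Ideal.map_pow]
    exact sup_le_sup_left
      (Ideal.pow_right_mono (IsLocalRing.map_maximalIdeal_le (algebraMap A B)) k) _
  refine Submodule.smul_mono_left hle ?_
  rw [Ideal.mem_map_smul_top_iff]
  exact Module.Flat.mem_smul_top_of_map_mem_of_pow_le (φ := Algebra.lsmul A A M y) hy _
    le_sup_right (Submodule.smul_mono_left le_sup_left hz)

theorem IsSMulRegular.of_flat_of_quotient [Module.Flat A M] {y : B}
    (hy : IsSMulRegular
      (M ⧸ ((maximalIdeal A).map (algebraMap A B) • (⊤ : Submodule B M))) y) :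
    IsSMulRegular M y := by
  rw [isSMulRegular_iff_right_eq_zero_of_smul]
  intro z hz
  simpa using hy.mem_smul_top_of_flat ⊥ (z := z) (by simp [hz])

open scoped Pointwise in
theorem IsSMulRegular.flat_quotSMulTop [Module.Flat A M] {y : B}
    (hy : IsSMulRegular
      (M ⧸ ((maximalIdeal A).map (algebraMap A B) • (⊤ : Submodule B M))) y) :
    Module.Flat A (QuotSMulTop y M) := by
  let π : M →ₗ[A] QuotSMulTop y M := (y • (⊤ : Submodule B M)).mkQ.restrictScalars A
  have hex : Function.Exact (Algebra.lsmul A A M y) π := fun x => by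
    simp [π, Submodule.mem_smul_pointwise_iff_exists]
  have hπ : Function.Surjective π := (y • (⊤ : Submodule B M)).mkQ_surjective
  exact Module.Flat.of_exact_of_forall_mem_smul_top hex hπ fun I _ => hy.mem_smul_top_of_flat I

theorem RingTheory.Sequence.IsWeaklyRegular.append_map_of_flat [Module.Flat A M]
    {xs : List A} (hxs : IsWeaklyRegular A xs) {ys : List B}
    (hys : IsWeaklyRegular
      (M ⧸ ((maximalIdeal A).map (algebraMap A B) • (⊤ : Submodule B M))) ys) :
    IsWeaklyRegular M (ys ++ xs.map (algebraMap A B)) := by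
  induction ys generalizing M with
  | nil =>
    rw [List.nil_append, isWeaklyRegular_map_algebraMap_iff]
    exact ((TensorProduct.rid A M).isWeaklyRegular_congr xs).mp hxs.isWeaklyRegular_lTensor
  | cons y ys ih =>
    rw [isWeaklyRegular_cons_iff] at hys
    have := hys.1.flat_quotSMulTop
    exact (ih (((QuotSMulTop.quotientSMulTopEquiv _ y).isWeaklyRegular_congr ys).mp hys.2)).cons
      hys.1.of_flat_of_quotient

end LocalFlat

section Depth

open RingTheory.Sequence

variable (A B : Type*) [CommRing A] [CommRing B] [IsNoetherianRing A] [IsNoetherianRing B]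
  [IsLocalRing A] [IsLocalRing B] [Algebra A B] [IsLocalHom (algebraMap A B)]

theorem idealDepth_add_idealDepth_fiber_le [Module.Flat A B] :
    idealDepth (maximalIdeal A) A +
      idealDepth ((maximalIdeal B).map (Ideal.Quotient.mk ((maximalIdeal A).map (algebraMap A B))))
        (B ⧸ (maximalIdeal A).map (algebraMap A B)) ≤ ringDepth B := by
  have : Nontrivial (B ⧸ (maximalIdeal A).map (algebraMap A B)) := Ideal.Quotient.nontrivial_iff.mpr
    (IsLocalRing.map_maximalIdeal_lt_top (algebraMap A B)).ne
  rw [idealDepth, idealDepth, sSup_eq_iSup, sSup_eq_iSup]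
  refine ENat.biSup_add_biSup_le' ⟨0, [], by simp, by simp, .nil _ _⟩
    ⟨0, [], by simp, by simp, .nil _ _⟩ ?_
  rintro _ ⟨xs, rfl, hxs, hxs'⟩ _ ⟨zs, rfl, hzs, hzs'⟩
  obtain ⟨ys, hys, rfl⟩ : ∃ ys : List B, (∀ y ∈ ys, y ∈ maximalIdeal B) ∧
      ys.map (algebraMap B (B ⧸ (maximalIdeal A).map (algebraMap A B))) = zs := by
    choose! g hg hg' using fun z (hz : z ∈ zs) => (Ideal.mem_map_iff_of_surjective _
      (Ideal.Quotient.mk_surjective (I := (maximalIdeal A).map (algebraMap A B)))).mp (hzs z hz)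
    exact ⟨zs.map g, by simpa using hg, by
      rw [List.map_map]
      exact (List.map_congr_left hg').trans (List.map_id zs)⟩
  have hmem : ∀ r ∈ ys ++ xs.map (algebraMap A B), r ∈ maximalIdeal B := by
    intro r hr
    rcases List.mem_append.mp hr with hr | hr
    · exact hys r hr
    · obtain ⟨x, hx, rfl⟩ := List.mem_map.mp hr
      exact IsLocalRing.map_maximalIdeal_le (algebraMap A B) (Ideal.mem_map_of_mem _ (hxs x hx))
  have hys' := (isWeaklyRegular_map_algebraMap_iff _ _ ys).mp hzs'.toIsWeaklyRegular
  refine le_sSup ⟨ys ++ xs.map (algebraMap A B), by simp [add_comm], hmem,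
    (IsLocalRing.isRegular_iff_isWeaklyRegular_of_subset_maximalIdeal hmem).mpr <|
      hxs'.toIsWeaklyRegular.append_map_of_flat ?_⟩
  refine ((Submodule.quotEquivOfEq _ _ ?_).isWeaklyRegular_congr ys).mp hys'
  rw [smul_eq_mul, Ideal.mul_top]

end Depth

theorem ringKrullDim_le_add_fiber (A B : Type*) [CommRing A] [CommRing B]
    [IsNoetherianRing A] [IsNoetherianRing B]
    [IsLocalRing A] [IsLocalRing B] [Algebra A B] [IsLocalHom (algebraMap A B)] :
    ringKrullDim B ≤ ringKrullDim A + ringKrullDim (B ⧸ (maximalIdeal A).map (algebraMap A B)) := by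
  have hle := IsLocalRing.map_maximalIdeal_le (algebraMap A B)
  rw [← maximalIdeal_height_eq_ringKrullDim, ← maximalIdeal_height_eq_ringKrullDim (R := A)]
  refine (WithBot.coe_le_coe.mpr
    (Ideal.height_le_height_add_of_liesOver (maximalIdeal A) (maximalIdeal B))).trans ?_
  rw [WithBot.coe_add]
  gcongr
  refine Ideal.height_le_ringKrullDim_of_ne_top fun h => ?_
  have h' := Ideal.comap_map_of_surjective _ (Ideal.Quotient.mk_surjective
    (I := (maximalIdeal A).map (algebraMap A B))) (maximalIdeal B)
  rw [h, Ideal.comap_top, ← RingHom.ker_eq_comap_bot, Ideal.mk_ker, sup_eq_left.mpr hle] at h'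
  exact Ideal.IsPrime.ne_top' h'.symm

theorem almostCM_ascends_along_flat {A B : Type*} [CommRing A] [CommRing B]
    [IsNoetherianRing A] [IsNoetherianRing B] [IsLocalRing A] [IsLocalRing B]
    [Algebra A B] [Module.Flat A B] [IsLocalHom (algebraMap A B)]
    (hA : IsAlmostCM A)
    (hF : IsAlmostCMWith (B ⧸ (maximalIdeal A).map (algebraMap A B))
      ((maximalIdeal B).map (Ideal.Quotient.mk ((maximalIdeal A).map (algebraMap A B)))))
    (hone : IsCMWith A (maximalIdeal A) ∨
      IsCMWith (B ⧸ (maximalIdeal A).map (algebraMap A B))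
        ((maximalIdeal B).map (Ideal.Quotient.mk ((maximalIdeal A).map (algebraMap A B))))) :
    IsAlmostCM B := by
  have hdim := ringKrullDim_le_add_fiber A B
  have hdepth := idealDepth_add_idealDepth_fiber_le A B
  unfold IsAlmostCM IsAlmostCMWith IsCMWith ringDepth at *
  rcases hone with h | h
  · calc ringKrullDim B ≤ _ := hdim
      _ ≤ _ := add_le_add h.le hF
      _ ≤ _ := by
        rw [← WithBot.coe_add, WithBot.coe_le_coe, add_left_comm]
        gcongr
  · calc ringKrullDim B ≤ _ := hdim
      _ ≤ _ := add_le_add hA h.le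
      _ ≤ _ := by
        rw [← WithBot.coe_add, WithBot.coe_le_coe, add_assoc]
        gcongr
end
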